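/- Let Q be a commutative A-loop of exponent 2. Then the operation x∘y = x\((xy)\x) makes Q into an elementary abelian 2-group; consequently, a finite commutative A-loop of exponent 2 has order a power of 2. -/

import Mathlib

/-- A commutative loop: commutative binary operation with two-sided identity
and a left division making all translations bijective. -/
class CommLoop (Q : Type*) extends Mul Q, One Q where
  mul_comm : ∀ x y : Q, x * y = y * x
  one_mul : ∀ x : Q, 1 * x = x
  mul_one : ∀ x : Q, x * 1 = x
  ldiv : Q → Q → Q
  mul_ldiv : ∀ x y : Q, x * ldiv x y = y
  ldiv_mul : ∀ x y : Q, ldiv x (x * y) = y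

namespace CommLoop

variable {Q : Type*} [CommLoop Q]

/-- The inverse `x⁻¹ = x \ 1`. -/
def inv (x : Q) : Q := ldiv x 1

/-- The inner mapping `L_{x,y} = L_x L_y L_{yx}⁻¹` (permutations acting on the right):
`z L_{x,y} = (yx) \ (y(xz))`. -/
def inn (x y z : Q) : Q := ldiv (y * x) (y * (x * z))

/-- Natural powers: `x^n = 1 L_x^n`. -/
def npow (x : Q) (n : ℕ) : Q := (fun y => x * y)^[n] 1

/-- Integer powers: `x^n = 1 L_x^n`. -/
def zpow (x : Q) : ℤ → Q
  | Int.ofNat n => npow x n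
  | Int.negSucc n => (fun y => ldiv x y)^[n + 1] 1

/-- A commutative A-loop: every inner mapping `L_{x,y}` is an automorphism. -/
class IsALoop (Q : Type*) [CommLoop Q] : Prop where
  inn_mul : ∀ x y u v : Q, inn x y (u * v) = inn x y u * inn x y v

/-- The left translation `L_x` as a permutation of `Q`. -/
def Le (x : Q) : Equiv.Perm Q :=
  ⟨fun y => x * y, fun y => ldiv x y, fun y => ldiv_mul x y, fun y => mul_ldiv x y⟩

/-- The permutation `P_x = L_x L_{x⁻¹}⁻¹`. -/
def Pe (x : Q) : Equiv.Perm Q := (Le x).trans (Le (inv x)).symm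

end CommLoop

namespace CommLoop

/-- The associated operation `x ∘ y = x \ ((xy) \ x)` on a commutative A-loop of
exponent 2. -/
def sop {Q : Type*} [CommLoop Q] (x y : Q) : Q := ldiv x (ldiv (x * y) x)

end CommLoop

namespace CommLoop

set_option linter.unusedSectionVars false

/-- Every element of the loop squares to the identity. -/
class ExponentTwo (Q : Type*) [CommLoop Q] : Prop where
  mul_self : ∀ x : Q, x * x = 1

variable {Q : Type*} [CommLoop Q]

theorem inn_eq (x y z : Q) : ldiv (x * y) (y * (x * z)) = inn x y z := by
  rw [mul_comm x y, inn]

theorem sop_eq (x y : Q) : ldiv x (ldiv (x * y) x) = sop x y := rfl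

theorem inn_apply_right (x y : Q) : inn x y y = y := by
  rw [inn, mul_comm x y, mul_comm y (y * x), ldiv_mul]

theorem mul_mul_sop (x y : Q) : x * y * (x * sop x y) = x := by
  rw [sop, mul_ldiv, mul_ldiv]

theorem sop_sop_self (x y : Q) : sop x (sop x y) = y := by
  have h1 := mul_mul_sop x y
  have h2 := sop_eq x (sop x y)
  have h3 := mul_mul_sop y x
  have h4 := ldiv_mul (x * sop x y) (x * y)
  have h5 := ldiv_mul x y
  grind only [mul_comm]

variable [IsALoop Q]

theorem inn_mul_inn (x y z w : Q) : inn x y z * inn x y w = inn x y (z * w) :=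
  (IsALoop.inn_mul x y z w).symm

theorem inn_mul_right (x y z : Q) : inn x y (y * z) = y * inn x y z := by
  rw [← inn_mul_inn, inn_apply_right]

theorem inn_ldiv_right (x y z : Q) : inn x y (ldiv y z) = ldiv y (inn x y z) := by
  rw [← ldiv_mul y (inn x y (ldiv y z)), ← inn_mul_right, mul_ldiv]

variable [ExponentTwo Q]

theorem mul_self (x : Q) : x * x = 1 := ExponentTwo.mul_self x

theorem inn_apply_left (x y : Q) : inn x y x = ldiv (x * y) y := by
  rw [← inn_eq, mul_self, mul_one]

theorem mul_mul_ldiv_comm (x y : Q) : x * (y * ldiv x y) = y * (x * ldiv y x) := by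
  have h1 := inn_ldiv_right (ldiv x y) x y
  have h2 := inn_apply_left (ldiv x y) x
  have h3 := mul_ldiv x y
  have h4 := inn_eq (ldiv x y) x y
  have h5 := inn_mul_right (ldiv x y) x (ldiv x y)
  have h6 := mul_ldiv (x * ldiv x y) (x * (ldiv x y * y))
  grind only [mul_comm]

theorem sop_comm (x y : Q) : sop x y = sop y x := by
  have h1 := inn_apply_left x y
  have h2 := inn_apply_left y x
  have h3 := inn_ldiv_right x y x
  have h4 := inn_ldiv_right y x y
  have h5 := inn_eq x y (ldiv y x)
  have h6 := inn_eq y x (ldiv x y)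
  have h7 := mul_mul_ldiv_comm x y
  have h8 := sop_eq x y
  have h9 := sop_eq y x
  grind only [mul_comm]

theorem inn_x_y_ldiv_x_z (x y z : Q) : inn x y (ldiv x z) = ldiv (x * y) (y * z) := by
  have h1 := inn_eq x y (ldiv x z)
  have h2 := mul_ldiv x z
  grind only

theorem ldiv_ldiv_x_y_y (x y : Q) : ldiv (ldiv x y) y = x := by
  have h1 := ldiv_mul (ldiv x y) x
  have h2 := mul_ldiv x y
  grind only [mul_comm]

theorem ldiv_mul_x_y_y (x y : Q) : ldiv (x * y) y = y * (sop x y) := by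
  have h1 := mul_ldiv y (ldiv (x * y) y)
  have h2 := sop_eq y x
  grind only [mul_comm, sop_comm]

theorem inn_x_y_x (x y : Q) : inn x y x = y * (sop x y) := by
  have h1 := ldiv_mul_x_y_y x y
  have h2 := inn_eq x y x
  have h3 := mul_self x
  have h4 := one_mul y
  grind only [mul_comm]

theorem mul_x_sop_x_ldiv_x_y (x y : Q) : x * (sop x (ldiv x y)) = ldiv y x := by
  have h1 := ldiv_mul_x_y_y (ldiv x y) x
  have h2 := mul_ldiv x y
  grind only [mul_comm, sop_comm]

theorem ldiv_x_ldiv_y_x (x y : Q) : ldiv x (ldiv y x) = inn y (ldiv y x) y := by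
  have h1 := mul_x_sop_x_ldiv_x_y (ldiv y x) x
  have h2 := ldiv_ldiv_x_y_y y x
  have h3 := inn_x_y_x y (ldiv y x)
  grind only [sop_comm]

theorem mul_mul_x_y_inn_y_x_z (x y z : Q) : (x * y) * (inn y x z) = x * (y * z) := by
  have h1 := mul_ldiv (x * y) (x * (y * z))
  have h2 := inn_eq y x z
  grind only [mul_comm]

theorem mul_inn_x_y_z_mul_y_inn_x_y_w (x y z w : Q) :
    (inn x y z) * (y * (inn x y w)) = inn x y (z * (y * w)) := by
  have h1 := inn_mul_inn x y z (y * w)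
  have h2 := inn_mul_right x y w
  grind only

theorem ldiv_sop_x_ldiv_x_y_ldiv_y_x (x y : Q) : ldiv (sop x (ldiv x y)) (ldiv y x) = x := by
  have h1 := ldiv_mul (sop x (ldiv x y)) x
  have h2 := mul_x_sop_x_ldiv_x_y x y
  grind only [mul_comm]

theorem sop_x_inn_y_ldiv_y_x_y (x y : Q) : sop x (inn y (ldiv y x) y) = ldiv x y := by
  have h1 := ldiv_x_ldiv_y_x x y
  have h2 := ldiv_ldiv_x_y_y (sop x (ldiv x (ldiv y x))) y
  have h3 := ldiv_sop_x_ldiv_x_y_ldiv_y_x x (ldiv y x)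
  have h4 := ldiv_ldiv_x_y_y y x
  grind only

theorem ldiv_y_inn_x_y_x (x y : Q) : ldiv y (inn x y x) = sop x y := by
  have h1 := ldiv_mul y (sop x y)
  have h2 := inn_x_y_x x y
  grind only

theorem ldiv_inn_x_y_z_inn_x_y_w (x y z w : Q) :
    ldiv (inn x y z) (inn x y w) = inn x y (ldiv z w) := by
  have h1 := mul_ldiv z w
  have h2 := ldiv_mul (inn x y z) (inn x y (ldiv z w))
  have h3 := inn_mul_inn x y (ldiv z w) z
  grind only [mul_comm]

theorem inn_inn_x_y_z_inn_x_y_w_y (x y z w : Q) :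
    inn (inn x y z) (inn x y w) y = inn x y (inn z w y) := by
  have h1 := inn_eq (inn x y z) (inn x y w) y
  have h2 := mul_inn_x_y_z_mul_y_inn_x_y_w x y w z
  have h3 := inn_mul_inn x y w z
  have h4 := ldiv_inn_x_y_z_inn_x_y_w x y (z * w) (w * (y * z))
  have h5 := inn_eq z w y
  grind only [mul_comm]

theorem inn_y_x_sop_x_z (x y z : Q) : inn y x (sop x z) = sop x (inn y x z) := by
  have h1 := ldiv_y_inn_x_y_x x (inn y x z)
  have h2 := ldiv_inn_x_y_z_inn_x_y_w y x z (inn x z x)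
  have h3 := ldiv_y_inn_x_y_x x z
  have h4 := inn_inn_x_y_z_inn_x_y_w_y y x x z
  have h5 := inn_apply_right y x
  grind only

theorem inn_mul_y_sop_x_y_y_x (x y : Q) : inn (y * (sop x y)) y x = inn x y x := by
  have h1 := inn_x_y_x x y
  have h2 := sop_sop_self y (inn (inn x y x) y x)
  have h3 := sop_sop_self y (inn x y x)
  have h4 := ldiv_y_inn_x_y_x (inn x y x) y
  have h5 := ldiv_mul y (sop y (inn (inn x y x) y x))
  have h6 := inn_mul_right (inn x y x) y (sop x y)
  have h7 := inn_y_x_sop_x_z y (inn x y x) x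
  grind only [sop_comm]

theorem inn_x_y_inn_x_ldiv_x_y_x (x y : Q) : inn x y (inn x (ldiv x y) x) = x := by
  have h1 := inn_mul_y_sop_x_y_y_x (inn x (ldiv x y) x) y
  have h2 := sop_x_inn_y_ldiv_y_x_y y x
  have h3 := inn_x_y_x (inn x (ldiv x y) x) y
  have h4 := mul_ldiv y x
  grind only [sop_comm]

theorem inn_x_y_mul_ldiv_x_y_z (x y z : Q) : inn x y ((ldiv x y) * z) = y * (x * z) := by
  have h1 := mul_inn_x_y_z_mul_y_inn_x_y_w x y z (inn x (ldiv x y) x)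
  have h2 := inn_x_y_inn_x_ldiv_x_y_x x y
  have h3 := mul_mul_x_y_inn_y_x_z y x z
  have h4 := mul_ldiv y (ldiv x y)
  have h5 := ldiv_x_ldiv_y_x y x
  grind only [mul_comm]

theorem mul_x_mul_y_ldiv_ldiv_y_x_z (x y z : Q) : x * (y * (ldiv (ldiv y x) z)) = inn y x z := by
  have h1 := inn_x_y_mul_ldiv_x_y_z y x (ldiv (ldiv y x) z)
  have h2 := mul_ldiv (ldiv y x) z
  grind only

theorem mul_x_ldiv_ldiv_x_y_z (x y z : Q) : x * (ldiv (ldiv x y) z) = ldiv y (inn x y z) := by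
  have h1 := ldiv_mul y (x * (ldiv (ldiv x y) z))
  have h2 := mul_x_mul_y_ldiv_ldiv_y_x_z y x z
  grind only

theorem ldiv_x_inn_ldiv_y_x_x_z (x y z : Q) :
    ldiv x (inn (ldiv y x) x z) = (ldiv y x) * (ldiv y z) := by
  have h1 := mul_x_ldiv_ldiv_x_y_z (ldiv y x) x z
  have h2 := ldiv_ldiv_x_y_y y x
  grind only

theorem mul_mul_x_y_mul_x_ldiv_y_z (x y z : Q) : (x * y) * (x * (ldiv y z)) = inn x (x * y) z := by
  have h1 := mul_x_mul_y_ldiv_ldiv_y_x_z (x * y) x z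
  have h2 := ldiv_mul x y
  grind only

theorem mul_ldiv_x_y_ldiv_x_mul_y_z (x y z : Q) :
    (ldiv x y) * (ldiv x (y * z)) = inn (ldiv x y) y z := by
  have h1 := ldiv_x_inn_ldiv_y_x_x_z y x (y * z)
  have h2 := inn_mul_right (ldiv x y) y z
  have h3 := ldiv_mul y (inn (ldiv x y) y z)
  grind only

theorem inn_mul_x_y_x_z (x y z : Q) : inn (x * y) x z = inn (sop x y) x z := by
  have h1 := sop_sop_self x y
  have h2 := mul_ldiv_x_y_ldiv_x_mul_y_z (x * (sop x y)) x z
  have h3 := inn_x_y_ldiv_x_z (sop x y) x z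
  have h4 := ldiv_mul_x_y_y (sop x y) x
  have h5 := mul_ldiv (sop x y) z
  have h6 := inn_mul_inn (sop x y) x (sop x y) (ldiv (sop x y) z)
  have h7 := inn_x_y_x (sop x y) x
  grind only [mul_comm, sop_comm]

theorem inn_sop_x_ldiv_x_y_x_z (x y z : Q) : inn (sop x (ldiv x y)) x z = inn y x z := by
  have h1 := inn_mul_x_y_x_z x (ldiv x y) z
  have h2 := mul_ldiv x y
  grind only

theorem inn_ldiv_x_y_y_z (x y z : Q) : inn (ldiv x y) y z = inn (ldiv y x) y z := by
  have h1 := inn_sop_x_ldiv_x_y_x_z y (ldiv x y) z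
  have h2 := ldiv_x_ldiv_y_x y x
  have h3 := sop_x_inn_y_ldiv_y_x_y y x
  grind only

theorem ldiv_x_ldiv_y_inn_x_y_z (x y z : Q) : ldiv x (ldiv y (inn x y z)) = ldiv (ldiv x y) z := by
  have h1 := ldiv_mul x (ldiv (ldiv x y) z)
  have h2 := mul_x_ldiv_ldiv_x_y_z x y z
  grind only

theorem ldiv_ldiv_x_y_mul_y_z (x y z : Q) : ldiv (ldiv x y) (y * z) = ldiv x (inn x y z) := by
  have h1 := ldiv_x_ldiv_y_inn_x_y_z x y (y * z)
  have h2 := inn_mul_right x y z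
  have h3 := ldiv_mul y (inn x y z)
  grind only

theorem mul_ldiv_z_x_ldiv_z_inn_z_x_y (x y z : Q) : (ldiv z x) * (ldiv z (inn z x y)) = x * y := by
  have h1 := mul_ldiv (ldiv z x) (x * y)
  have h2 := ldiv_ldiv_x_y_mul_y_z z x y
  grind only

theorem mul_x_mul_x_y (x y : Q) : x * (x * y) = inn x x y := by
  have h1 := mul_mul_x_y_inn_y_x_z x x y
  have h2 := mul_self x
  have h3 := one_mul (inn x x y)
  grind only

theorem ldiv_x_inn_x_x_y (x y : Q) : ldiv x (inn x x y) = x * y := by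
  have h1 := mul_x_mul_x_y x (ldiv x y)
  have h2 := mul_ldiv x y
  have h3 := inn_ldiv_right x x y
  grind only

theorem inn_x_ldiv_y_inn_x_y_z_z (x y z : Q) : inn x (ldiv y (inn x y z)) z = inn x y z := by
  have h1 := mul_x_ldiv_ldiv_x_y_z x y z
  have h2 := mul_ldiv x y
  have h3 := mul_mul_x_y_mul_x_ldiv_y_z x (ldiv (ldiv x y) z) z
  have h4 := ldiv_ldiv_x_y_y (ldiv x y) z
  have h5 := mul_mul_x_y_mul_x_ldiv_y_z x (ldiv x y) z
  grind only [mul_comm]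

theorem mul_x_ldiv_y_mul_mul_x_y_z (x y z : Q) : x * (ldiv y ((x * y) * z)) = inn x (x * y) z := by
  have h1 := mul_ldiv_x_y_ldiv_x_mul_y_z y (x * y) z
  have h2 := ldiv_mul y x
  grind only [mul_comm]

theorem inn_x_mul_x_y_inn_x_y_z (x y z : Q) : inn x (x * y) (inn x y z) = inn x x z := by
  have h1 := mul_x_ldiv_y_mul_mul_x_y_z x y (inn x y z)
  have h2 := mul_mul_x_y_inn_y_x_z y x z
  have h3 := ldiv_mul y (x * z)
  have h4 := mul_x_mul_x_y x z
  grind only [mul_comm]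

theorem inn_x_y_ldiv_x_mul_y_z (x y z : Q) :
    inn x y (ldiv x (y * z)) = y * (ldiv x (inn y x z)) := by
  have h1 := inn_x_y_ldiv_x_z x y (y * z)
  have h2 := mul_x_mul_x_y y z
  have h3 := mul_x_ldiv_ldiv_x_y_z y (x * y) (inn y x z)
  have h4 := inn_x_mul_x_y_inn_x_y_z y x z
  have h5 := ldiv_mul y x
  grind only [mul_comm]

theorem inn_sop_x_z_x_inn_z_x_y (x y z : Q) : inn (sop x z) x (inn z x y) = inn x x y := by
  have h1 := inn_x_y_ldiv_x_mul_y_z (x * z) x (y * z)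
  have h2 := inn_eq z x y
  have h3 := mul_x_ldiv_ldiv_x_y_z x (x * z) (y * z)
  have h4 := ldiv_mul x z
  have h5 := ldiv_mul z y
  have h6 := mul_x_mul_x_y x y
  have h7 := inn_mul_x_y_x_z x z (inn z x y)
  grind only [mul_comm]

theorem inn_sop_x_z_y_ldiv_x_inn_z_x_y (x y z : Q) :
    inn (sop x z) y (ldiv x (inn z x y)) = x * y := by
  have h1 := mul_ldiv x y
  have h2 := inn_ldiv_right x x y
  have h3 := ldiv_x_inn_x_x_y x y
  have h4 := inn_ldiv_right z x y
  have h5 := inn_x_ldiv_y_inn_x_y_z_z (sop x z) x (inn z x (ldiv x y))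
  have h6 := inn_sop_x_z_x_inn_z_x_y x (ldiv x y) z
  have h7 := ldiv_x_inn_x_x_y x (ldiv x y)
  grind only

theorem inn_ldiv_sop_y_z_x_x_y (x y z : Q) :
    inn (ldiv (sop y z) x) x y = x * (ldiv y (inn z y x)) := by
  have h1 := mul_ldiv_z_x_ldiv_z_inn_z_x_y x (ldiv y (inn z y x)) (sop y z)
  have h2 := inn_sop_x_z_y_ldiv_x_inn_z_x_y y x z
  have h3 := mul_ldiv_x_y_ldiv_x_mul_y_z (sop y z) x y
  grind only [mul_comm]

theorem inn_ldiv_x_sop_x_y_x_z (x y z : Q) : inn (ldiv x (sop x y)) x z = inn y x z := by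
  have h1 := inn_ldiv_sop_y_z_x_x_y z x y
  have h2 := inn_ldiv_x_y_y_z (sop x y) x z
  have h3 := ldiv_mul z (ldiv x (inn y x z))
  have h4 := mul_ldiv x (inn y x z)
  have h5 := mul_mul_x_y_mul_x_ldiv_y_z (ldiv (sop x y) x) (sop x y) z
  have h6 := ldiv_x_inn_ldiv_y_x_x_z z (sop x y) x
  have h7 := mul_ldiv (sop x y) x
  grind only [mul_comm]

theorem inn_ldiv_x_y_x_z (x y z : Q) : inn (ldiv x y) x z = inn (sop x y) x z := by
  have h1 := inn_ldiv_x_sop_x_y_x_z x (sop x y) z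
  have h2 := sop_sop_self x y
  grind only

theorem inn_sop_x_y_y_ldiv_ldiv_y_x_z (x y z : Q) :
    inn (sop x y) y (ldiv (ldiv y x) z) = ldiv x (y * z) := by
  have h1 := inn_x_y_ldiv_x_z (ldiv y x) y z
  have h2 := inn_ldiv_x_y_x_z y x (ldiv (ldiv y x) z)
  have h3 := mul_ldiv y x
  grind only [mul_comm, sop_comm]

theorem mul_x_ldiv_y_ldiv_z_mul_x_y (x y z : Q) :
    x * (ldiv y (ldiv z (x * y))) = sop (x * y) (x * (ldiv y z)) := by
  have h1 := mul_x_ldiv_y_mul_mul_x_y_z x y (sop (x * y) (ldiv (x * y) z))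
  have h2 := mul_x_sop_x_ldiv_x_y (x * y) z
  have h3 := inn_y_x_sop_x_z (x * y) x (ldiv (x * y) z)
  have h4 := inn_ldiv_right x (x * y) z
  have h5 := mul_x_ldiv_ldiv_x_y_z x (x * y) z
  have h6 := ldiv_mul x y
  grind only

theorem mul_y_mul_z_ldiv_ldiv_z_x_ldiv_z_y (x y z : Q) :
    y * (z * (ldiv (ldiv z x) (ldiv z y))) = sop (x * y) (y * z) := by
  have h1 := mul_x_ldiv_y_ldiv_z_mul_x_y y z (x * z)
  have h2 := ldiv_mul z x
  have h3 := mul_x_ldiv_ldiv_x_y_z z x (ldiv z y)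
  have h4 := inn_ldiv_right z z y
  have h5 := ldiv_x_inn_x_x_y z y
  have h6 := ldiv_x_ldiv_y_inn_x_y_z z (x * z) (inn z x (ldiv z y))
  have h7 := inn_x_mul_x_y_inn_x_y_z z x (ldiv z y)
  grind only [mul_comm, sop_comm]

theorem ldiv_ldiv_x_y_x (x y : Q) : ldiv (ldiv x y) x = ldiv x (sop x y) := by
  have h1 := ldiv_x_ldiv_y_inn_x_y_z x y x
  have h2 := inn_x_y_x x y
  have h3 := ldiv_mul y (sop x y)
  grind only

theorem inn_y_x_sop_z_ldiv_y_x (x y z : Q) :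
    inn y x (sop z (ldiv y x)) = sop (x * y) (inn y x z) := by
  have h1 := ldiv_ldiv_x_y_x (ldiv y x) z
  have h2 := mul_x_mul_y_ldiv_ldiv_y_x_z x y z
  have h3 := mul_x_mul_y_ldiv_ldiv_y_x_z x y (sop z (ldiv y x))
  have h4 := mul_y_mul_z_ldiv_ldiv_z_x_ldiv_z_y (y * (ldiv (ldiv y x) z)) x y
  have h5 := ldiv_mul y (ldiv (ldiv y x) z)
  grind only [mul_comm, sop_comm]

theorem ldiv_x_sop_mul_x_z_inn_x_x_y (x y z : Q) :
    ldiv x (sop (x * z) (inn x x y)) = x * (sop y (ldiv x z)) := by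
  have h1 := ldiv_x_inn_x_x_y x (sop y (ldiv x z))
  have h2 := inn_x_mul_x_y_inn_x_y_z x z (sop y (ldiv x z))
  have h3 := inn_y_x_sop_z_ldiv_y_x z x y
  have h4 := inn_y_x_sop_x_z (x * z) x (inn x z y)
  have h5 := inn_x_mul_x_y_inn_x_y_z x z y
  grind only [mul_comm]

theorem ldiv_x_ldiv_z_inn_y_z_ldiv_y_x (x y z : Q) :
    ldiv x (ldiv z (inn y z (ldiv y x))) = sop (ldiv x y) (ldiv x z) := by
  have h1 := ldiv_mul x (sop (ldiv x y) (ldiv x z))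
  have h2 := mul_x_ldiv_ldiv_x_y_z y z (ldiv y x)
  have h3 := ldiv_mul x (y * (ldiv (ldiv y z) (ldiv y x)))
  have h4 := mul_y_mul_z_ldiv_ldiv_z_x_ldiv_z_y z x y
  have h5 := ldiv_x_sop_mul_x_z_inn_x_x_y x (ldiv x y) z
  have h6 := inn_ldiv_right x x y
  have h7 := ldiv_x_inn_x_x_y x y
  grind only [mul_comm]

theorem inn_ldiv_x_y_y_z_eq_inn_sop_x_y_y_z (x y z : Q) :
    inn (ldiv x y) y z = inn (sop x y) y z := by
  have h1 := inn_ldiv_x_y_y_z x y z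
  have h2 := inn_ldiv_x_y_x_z y x z
  grind only [sop_comm]

theorem sop_mul_x_y_inn_sop_x_z_x_y (x y z : Q) :
    sop (x * y) (inn (sop x z) x y) = inn (sop y z) y x := by
  have h1 := ldiv_mul x y
  have h2 := mul_ldiv_x_y_ldiv_x_mul_y_z z x y
  have h3 := inn_ldiv_x_y_y_z_eq_inn_sop_x_y_y_z z x y
  have h4 := mul_ldiv_x_y_ldiv_x_mul_y_z z y x
  have h5 := inn_ldiv_x_y_y_z_eq_inn_sop_x_y_y_z z y x
  have h6 := mul_x_ldiv_y_ldiv_z_mul_x_y (ldiv z (x * y)) z x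
  have h7 := mul_ldiv z (x * y)
  grind only [mul_comm, sop_comm]

theorem sop_mul_x_y_mul_x_sop_x_y (x y : Q) : sop (x * y) (x * (sop x y)) = inn x y x := by
  have h1 := sop_mul_x_y_inn_sop_x_z_x_y x (sop x y) y
  have h2 := inn_x_y_x (sop x y) x
  have h3 := sop_sop_self y x
  have h4 := sop_sop_self x y
  have h5 := inn_x_ldiv_y_inn_x_y_z_z x y x
  have h6 := inn_x_y_x x y
  have h7 := ldiv_mul y (sop x y)
  grind only [sop_comm]

theorem ldiv_inn_x_y_x_y (x y : Q) : ldiv (inn x y x) y = x * y := by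
  have h1 := ldiv_sop_x_ldiv_x_y_ldiv_y_x (x * y) x
  have h2 := ldiv_mul x y
  have h3 := ldiv_mul_x_y_y y x
  have h4 := sop_mul_x_y_mul_x_sop_x_y x y
  grind only [mul_comm, sop_comm]

theorem ldiv_x_sop_x_mul_x_y (x y : Q) : ldiv x (sop x (x * y)) = ldiv y x := by
  have h1 := ldiv_ldiv_x_y_x x (x * y)
  have h2 := ldiv_mul x y
  grind only

theorem inn_sop_x_y_x_y (x y : Q) : inn (sop x y) x y = sop x (x * y) := by
  have h1 := ldiv_y_inn_x_y_x (x * y) x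
  have h2 := inn_mul_x_y_x_z x y (x * y)
  have h3 := inn_mul_right (sop x y) x y
  have h4 := ldiv_mul x (inn (sop x y) x y)
  grind only [sop_comm]

theorem ldiv_x_ldiv_y_x_eq_sop_x_ldiv_x_y (x y : Q) : ldiv x (ldiv y x) = sop x (ldiv x y) := by
  have h1 := ldiv_y_inn_x_y_x (ldiv x y) x
  have h2 := inn_ldiv_right (ldiv x y) x y
  have h3 := inn_ldiv_x_y_x_z x y y
  have h4 := inn_sop_x_y_x_y x y
  have h5 := ldiv_x_sop_x_mul_x_y x y
  grind only [sop_comm]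

theorem ldiv_inn_x_y_ldiv_x_z_mul_y_z (x y z : Q) : ldiv (inn x y (ldiv x z)) (y * z) = x * y := by
  have h1 := ldiv_ldiv_x_y_y (x * y) (y * z)
  have h2 := inn_x_y_ldiv_x_z x y z
  grind only

theorem mul_mul_x_y_ldiv_inn_y_x_z_x (x y z : Q) :
    (x * y) * (ldiv (inn y x z) x) = x * (y * (ldiv z x)) := by
  have h1 := mul_mul_x_y_inn_y_x_z x y (ldiv z x)
  have h2 := ldiv_inn_x_y_z_inn_x_y_w y x z x
  have h3 := inn_apply_right y x
  grind only

theorem inn_sop_x_z_x_mul_y_z (x y z : Q) : inn (sop x z) x (y * z) = x * (y * (ldiv z x)) := by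
  have h1 := inn_ldiv_x_y_y_z_eq_inn_sop_x_y_y_z z x (y * z)
  have h2 := inn_x_y_mul_ldiv_x_y_z (ldiv z x) x y
  have h3 := ldiv_ldiv_x_y_y z x
  grind only [mul_comm, sop_comm]

theorem inn_sop_x_inn_ldiv_y_z_x_y_x_z (x y z : Q) :
    inn (sop x (inn (ldiv y z) x y)) x z = inn (sop x y) x z := by
  have h1 := mul_ldiv_x_y_ldiv_x_mul_y_z (inn (ldiv y z) x y) x z
  have h2 := inn_ldiv_x_y_y_z_eq_inn_sop_x_y_y_z (inn (ldiv y z) x y) x z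
  have h3 := mul_mul_x_y_ldiv_inn_y_x_z_x x (ldiv y z) y
  have h4 := ldiv_inn_x_y_ldiv_x_z_mul_y_z (ldiv y z) x z
  have h5 := ldiv_ldiv_x_y_y y z
  have h6 := inn_sop_x_z_x_mul_y_z x (ldiv y z) y
  have h7 := mul_ldiv y z
  grind only [mul_comm, sop_comm]

theorem inn_sop_y_inn_x_z_ldiv_x_y_y_z (x y z : Q) :
    inn (sop y (inn x z (ldiv x y))) y z = inn x y z := by
  have h1 := ldiv_ldiv_x_y_y x y
  have h2 := inn_ldiv_x_y_y_z_eq_inn_sop_x_y_y_z (ldiv x y) y z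
  have h3 := sop_mul_x_y_inn_sop_x_z_x_y z y (inn (ldiv (ldiv x y) y) z (ldiv x y))
  have h4 := inn_sop_x_inn_ldiv_y_z_x_y_x_z z (ldiv x y) y
  have h5 := sop_mul_x_y_inn_sop_x_z_x_y z y (ldiv x y)
  grind only [sop_comm]

theorem ldiv_ldiv_x_mul_y_z_z (x y z : Q) :
    ldiv (ldiv x (y * z)) z = ldiv x (inn (ldiv y x) z y) := by
  have h1 := mul_ldiv y x
  have h2 := inn_x_y_ldiv_x_z (ldiv y x) y z
  have h3 := inn_sop_y_inn_x_z_ldiv_x_y_y_z (ldiv y x) z y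
  have h4 := ldiv_inn_x_y_ldiv_x_z_mul_y_z (ldiv y x) y z
  have h5 := ldiv_mul (ldiv (inn (ldiv y x) y (ldiv (ldiv y x) z)) (y * z))
    (ldiv (inn (ldiv y x) y (ldiv (ldiv y x) z)) z)
  have h6 := mul_ldiv_x_y_ldiv_x_mul_y_z (inn (ldiv y x) y (ldiv (ldiv y x) z)) z y
  have h7 := inn_ldiv_x_y_y_z_eq_inn_sop_x_y_y_z (inn (ldiv y x) y (ldiv (ldiv y x) z)) z y
  grind only [mul_comm, sop_comm]

theorem inn_ldiv_x_y_z_x (x y z : Q) : inn (ldiv x y) z x = y * (ldiv (ldiv y (x * z)) z) := by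
  have h1 := mul_ldiv y (inn (ldiv x y) z x)
  have h2 := ldiv_ldiv_x_mul_y_z_z y x z
  grind only

theorem mul_ldiv_x_y_sop_x_y (x y : Q) : (ldiv x y) * (sop x y) = ldiv x (inn y y x) := by
  have h1 := inn_sop_x_y_y_ldiv_ldiv_y_x_z x y (x * y)
  have h2 := mul_x_mul_x_y y x
  have h3 := inn_ldiv_right (sop x y) y (x * (sop x y))
  have h4 := inn_sop_x_z_x_mul_y_z y (sop x y) x
  have h5 := ldiv_mul y ((ldiv x y) * (sop x y))
  have h6 := ldiv_ldiv_x_y_mul_y_z y x y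
  have h7 := inn_x_y_x y x
  grind only [mul_comm, sop_comm]

theorem ldiv_ldiv_x_y_ldiv_x_inn_y_y_x (x y : Q) :
    ldiv (ldiv x y) (ldiv x (inn y y x)) = sop x y := by
  have h1 := ldiv_mul (ldiv x y) (sop x y)
  have h2 := mul_ldiv_x_y_sop_x_y x y
  grind only

theorem inn_inn_x_y_z_inn_x_y_z_inn_x_y_w (x y z w : Q) :
    inn (inn x y z) (inn x y z) (inn x y w) = inn x y (inn z z w) := by
  have h1 := mul_x_mul_x_y (inn x y z) (inn x y w)
  have h2 := inn_mul_inn x y w z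
  have h3 := inn_mul_inn x y z (z * w)
  have h4 := mul_x_mul_x_y z w
  grind only [mul_comm]

theorem sop_inn_x_y_z_mul_y_sop_x_y (x y z : Q) :
    sop (inn x y z) (y * (sop x y)) = inn x y (sop x z) := by
  have h1 := inn_x_y_x x y
  have h2 := ldiv_ldiv_x_y_ldiv_x_inn_y_y_x (inn x y z) (inn x y x)
  have h3 := ldiv_inn_x_y_z_inn_x_y_w x y z x
  have h4 := inn_inn_x_y_z_inn_x_y_z_inn_x_y_w x y x z
  have h5 := ldiv_inn_x_y_z_inn_x_y_w x y z (inn x x z)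
  have h6 := ldiv_inn_x_y_z_inn_x_y_w x y (ldiv z x) (ldiv z (inn x x z))
  have h7 := ldiv_ldiv_x_y_ldiv_x_inn_y_y_x z x
  grind only [sop_comm]

theorem inn_mul_x_z_y_ldiv_x_inn_z_x_y (x y z : Q) :
    inn (x * z) y (ldiv x (inn z x y)) = x * y := by
  have h1 := ldiv_mul_x_y_y z x
  have h2 := inn_mul_x_y_x_z x (sop x z) y
  have h3 := sop_sop_self x z
  have h4 := inn_x_y_mul_ldiv_x_y_z (x * z) y (ldiv (x * z) x)
  have h5 := ldiv_x_inn_ldiv_y_x_x_z x (x * z) y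
  have h6 := mul_ldiv (x * z) x
  grind only [mul_comm, sop_comm]

theorem inn_sop_x_mul_y_z_x_y (x y z : Q) :
    inn (sop x (y * z)) x y = x * (ldiv y (inn z y x)) := by
  have h1 := inn_ldiv_x_y_x_z x (y * z) y
  have h2 := inn_ldiv_x_y_y_z (y * z) x y
  have h3 := mul_ldiv_z_x_ldiv_z_inn_z_x_y x (ldiv y (inn z y x)) (y * z)
  have h4 := inn_mul_x_z_y_ldiv_x_inn_z_x_y y x z
  have h5 := mul_ldiv_x_y_ldiv_x_mul_y_z (y * z) x y
  grind only [mul_comm]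

theorem inn_z_y_inn_sop_x_z_x_y (x y z : Q) :
    inn z y (inn (sop x z) x y) = (x * y) * (inn z y x) := by
  have h1 := inn_sop_x_mul_y_z_x_y (inn z y x) y (sop y z)
  have h2 := sop_inn_x_y_z_mul_y_sop_x_y z y x
  have h3 := inn_sop_x_z_x_inn_z_x_y y x z
  have h4 := ldiv_x_inn_x_x_y y x
  have h5 := inn_inn_x_y_z_inn_x_y_w_y z y (sop x z) x
  grind only [mul_comm, sop_comm]

theorem ldiv_ldiv_x_y_mul_z_ldiv_y_x (x y z : Q) :
    ldiv (ldiv x y) (z * (ldiv y x)) = ldiv x (z * (ldiv y (sop x y))) := by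
  have h1 := ldiv_x_ldiv_y_inn_x_y_z x y (z * (ldiv y x))
  have h2 := ldiv_mul y (z * (ldiv y (sop x y)))
  have h3 := inn_sop_x_ldiv_x_y_x_z y x (z * (ldiv y x))
  have h4 := inn_sop_x_z_x_mul_y_z y z (ldiv y x)
  have h5 := ldiv_ldiv_x_y_x y x
  grind only [sop_comm]

theorem ldiv_inn_x_inn_x_y_z_x_y (x y z : Q) :
    ldiv (inn x (inn x y z) x) y = ldiv (x * (inn x y z)) (y * z) := by
  have h1 := mul_ldiv_z_x_ldiv_z_inn_z_x_y y z x
  have h2 := mul_ldiv x y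
  have h3 := inn_x_y_x x (inn x y z)
  have h4 := ldiv_ldiv_x_y_mul_z_ldiv_y_x (x * (inn x y z)) (inn x y z) (ldiv x y)
  have h5 := ldiv_mul (inn x y z) x
  have h6 := ldiv_x_sop_x_mul_x_y (inn x y z) x
  have h7 := ldiv_mul_x_y_y x (inn x y z)
  grind only [mul_comm, sop_comm]

theorem inn_ldiv_x_mul_y_inn_y_z_x_z_x (x y z : Q) :
    inn (ldiv x (y * (inn y z x))) z x = inn y z x := by
  have h1 := inn_ldiv_x_y_z_x x (y * (inn y z x)) z
  have h2 := ldiv_inn_x_inn_x_y_z_x_y y z x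
  have h3 := ldiv_ldiv_x_y_y (inn y (inn y z x) y) z
  have h4 := mul_mul_x_y_inn_y_x_z (inn y z x) y y
  have h5 := mul_self y
  have h6 := one_mul (inn y z x)
  grind only [mul_comm]

theorem sop_x_inn_x_x_y (x y : Q) : sop x (inn x x y) = x * (inn y x y) := by
  have h1 := mul_x_mul_x_y x (sop x y)
  have h2 := inn_x_y_x y x
  have h3 := inn_y_x_sop_x_z x x y
  grind only [sop_comm]

theorem inn_sop_x_mul_x_y_x_z (x y z : Q) : inn (sop x (x * y)) x z = inn y x z := by
  have h1 := inn_ldiv_x_y_x_z x (x * y) z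
  have h2 := ldiv_mul x y
  grind only

theorem inn_inn_x_y_x_y_z (x y z : Q) : inn (inn x y x) y z = inn x y z := by
  have h1 := inn_sop_x_mul_x_y_x_z y (inn x y x) z
  have h2 := sop_x_inn_x_x_y y x
  have h3 := sop_sop_self y (inn y y x)
  have h4 := inn_mul_x_y_x_z y (x * y) z
  have h5 := mul_x_mul_x_y y x
  have h6 := inn_sop_x_mul_x_y_x_z y x z
  grind only [mul_comm]

theorem mul_x_ldiv_y_inn_z_y_x (x y z : Q) :
    x * (ldiv y (inn z y x)) = sop (x * y) (inn z y x) := by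
  have h1 := sop_mul_x_y_inn_sop_x_z_x_y y x (y * z)
  have h2 := inn_sop_x_mul_x_y_x_z y z x
  have h3 := inn_sop_x_mul_y_z_x_y x y z
  grind only [mul_comm]

theorem ldiv_z_sop_mul_x_z_inn_y_x_z (x y z : Q) :
    ldiv z (sop (x * z) (inn y x z)) = ldiv x (inn y x z) := by
  have h1 := ldiv_mul z (ldiv x (inn y x z))
  have h2 := mul_x_ldiv_y_inn_z_y_x z x y
  grind only [mul_comm]

theorem sop_mul_x_y_inn_z_y_x (x y z : Q) :
    sop (x * y) (inn z y x) = x * (z * (ldiv (ldiv z y) x)) := by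
  have h1 := mul_x_ldiv_y_inn_z_y_x x y z
  have h2 := mul_x_ldiv_ldiv_x_y_z z y x
  grind only

theorem inn_x_mul_y_z_inn_y_z_y (x y z : Q) : inn x (y * z) (inn y z y) = inn (ldiv y x) z y := by
  have h1 := ldiv_ldiv_x_mul_y_z_z x y z
  have h2 := mul_ldiv x (inn (ldiv y x) z y)
  have h3 := ldiv_inn_x_y_x_y y z
  have h4 := mul_x_ldiv_ldiv_x_y_z x (ldiv (inn y z y) z) z
  have h5 := inn_ldiv_right x (ldiv (inn y z y) z) z
  have h6 := ldiv_ldiv_x_y_y (inn y z y) z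
  grind only

theorem ldiv_x_inn_ldiv_ldiv_x_y_z_x_y (x y z : Q) :
    ldiv x (inn (ldiv (ldiv x y) z) x y) = ldiv y (inn z y x) := by
  have h1 := inn_x_mul_y_z_inn_y_z_y z (ldiv x y) x
  have h2 := mul_ldiv x y
  have h3 := inn_ldiv_right (ldiv (ldiv x y) z) x y
  have h4 := inn_x_y_x (ldiv x y) x
  have h5 := mul_x_sop_x_ldiv_x_y x y
  have h6 := inn_ldiv_right z y x
  grind only [mul_comm, sop_comm]

theorem inn_ldiv_ldiv_x_y_z_x_y (x y z : Q) :
    inn (ldiv (ldiv x y) z) x y = sop (x * y) (inn z y x) := by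
  have h1 := mul_ldiv x (inn (ldiv (ldiv x y) z) x y)
  have h2 := ldiv_x_inn_ldiv_ldiv_x_y_z_x_y x y z
  have h3 := mul_x_ldiv_y_inn_z_y_x x y z
  grind only

theorem inn_sop_x_inn_x_z_y_x_z (x y z : Q) : inn (sop x (inn x z y)) x z = inn (sop x y) x z := by
  have h1 := inn_ldiv_ldiv_x_y_z_x_y x z (y * z)
  have h2 := ldiv_ldiv_x_y_mul_y_z x z y
  have h3 := inn_mul_x_y_x_z z y x
  have h4 := sop_mul_x_y_inn_sop_x_z_x_y z x y
  have h5 := inn_ldiv_x_y_x_z x (inn x z y) z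
  grind only [mul_comm]

theorem inn_sop_z_ldiv_mul_x_z_y_z_x (x y z : Q) :
    inn (sop z (ldiv (x * z) y)) z x = inn (ldiv x y) z x := by
  have h1 := inn_sop_x_inn_x_z_y_x_z z (ldiv z (ldiv x y)) x
  have h2 := inn_sop_x_ldiv_x_y_x_z z (ldiv x y) x
  have h3 := inn_x_y_ldiv_x_z z x (ldiv x y)
  have h4 := mul_ldiv x y
  grind only [mul_comm]

theorem sop_mul_x_z_inn_ldiv_z_y_x_z (x y z : Q) :
    sop (x * z) (inn (ldiv z y) x z) = inn (ldiv x y) z x := by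
  have h1 := sop_mul_x_y_inn_sop_x_z_x_y x z (ldiv (x * z) y)
  have h2 := inn_sop_z_ldiv_mul_x_z_y_z_x z y x
  have h3 := inn_sop_z_ldiv_mul_x_z_y_z_x x y z
  grind only [mul_comm]

theorem inn_ldiv_x_inn_x_z_y_z_x (x y z : Q) : inn (ldiv x (inn x z y)) z x = inn (x * y) z x := by
  have h1 := inn_sop_x_inn_x_z_y_x_z z (ldiv z (x * y)) x
  have h2 := inn_x_y_ldiv_x_mul_y_z z x y
  have h3 := inn_sop_x_ldiv_x_y_x_z z (x * y) x
  have h4 := inn_sop_x_mul_y_z_x_y z x (ldiv z (inn x z y))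
  have h5 := mul_x_ldiv_y_inn_z_y_x z x (ldiv z (inn x z y))
  have h6 := sop_mul_x_z_inn_ldiv_z_y_x_z x (inn x z y) z
  grind only [mul_comm]

theorem inn_mul_x_mul_ldiv_x_y_z_y_x (x y z : Q) :
    inn (x * ((ldiv x y) * z)) y x = inn (sop y z) y x := by
  have h1 := inn_ldiv_x_inn_x_z_y_z_x x (z * (ldiv x y)) y
  have h2 := inn_x_y_mul_ldiv_x_y_z x y z
  have h3 := inn_mul_x_y_x_z x z y
  have h4 := sop_mul_x_y_inn_sop_x_z_x_y x y z
  have h5 := sop_mul_x_z_inn_ldiv_z_y_x_z x (y * (x * z)) y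
  have h6 := ldiv_mul y (x * z)
  grind only [mul_comm]

theorem inn_sop_x_ldiv_z_y_x_y (x y z : Q) :
    inn (sop x (ldiv z y)) x y = x * (ldiv y (inn z y x)) := by
  have h1 := inn_ldiv_x_y_y_z_eq_inn_sop_x_y_y_z (ldiv z y) x y
  have h2 := mul_ldiv_z_x_ldiv_z_inn_z_x_y x (ldiv y (inn z y x)) (ldiv z y)
  have h3 := mul_ldiv_x_y_ldiv_x_mul_y_z (ldiv z y) x y
  have h4 := inn_x_y_mul_ldiv_x_y_z (ldiv z y) x z
  have h5 := mul_x_ldiv_ldiv_x_y_z z y x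
  have h6 := mul_ldiv z y
  grind only [mul_comm, sop_comm]

theorem inn_inn_ldiv_x_y_z_x_y_z (x y z : Q) : inn (inn (ldiv x y) z x) y z = inn x y z := by
  have h1 := inn_mul_x_mul_ldiv_x_y_z_y_x z y (ldiv (ldiv (ldiv z y) x) z)
  have h2 := sop_mul_x_y_inn_z_y_x z x (ldiv z y)
  have h3 := inn_sop_x_ldiv_z_y_x_y y z (ldiv (ldiv z y) x)
  have h4 := inn_ldiv_ldiv_x_y_z_x_y z y x
  have h5 := ldiv_z_sop_mul_x_z_inn_y_x_z y x z
  have h6 := mul_ldiv y (inn x y z)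
  have h7 := sop_mul_x_z_inn_ldiv_z_y_x_z x y z
  grind only [mul_comm]

theorem inn_x_inn_y_z_mul_x_y_z (x y z : Q) :
    inn x (inn y z (x * y)) z = inn y z (inn x (x * y) z) := by
  have h1 := inn_inn_ldiv_x_y_z_x_y_z x (inn y z (x * y)) z
  have h2 := inn_inn_x_y_z_inn_x_y_w_y y z x (x * y)
  have h3 := inn_ldiv_x_mul_y_inn_y_z_x_z_x x (inn y z y) z
  have h4 := inn_inn_x_y_x_y_z y z x
  have h5 := inn_mul_inn y z y x
  grind only [mul_comm]

theorem inn_ldiv_z_x_mul_x_y_y (x y z : Q) : inn (ldiv z x) (x * y) y = (x * y) * (inn z y x) := by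
  have h1 := inn_x_ldiv_y_inn_x_y_z_z (ldiv z x) (inn z y x) y
  have h2 := ldiv_mul (inn z y x) (x * y)
  have h3 := inn_x_inn_y_z_mul_x_y_z (ldiv z x) z y
  have h4 := mul_ldiv z x
  have h5 := inn_ldiv_x_y_y_z_eq_inn_sop_x_y_y_z z x y
  have h6 := inn_z_y_inn_sop_x_z_x_y x y z
  grind only [mul_comm, sop_comm]

theorem inn_inn_x_z_x_y_mul_x_z (x y z : Q) : inn (inn x z x) y (x * z) = inn x y (x * z) := by
  have h1 := ldiv_mul_x_y_y z x
  have h2 := sop_mul_x_y_mul_x_sop_x_y x z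
  have h3 := mul_x_ldiv_ldiv_x_y_z (ldiv x (x * z)) (y * (x * z)) y
  have h4 := inn_ldiv_z_x_mul_x_y_y (x * z) y x
  have h5 := inn_ldiv_x_y_z_x (x * z) (ldiv x (x * z)) y
  have h6 := ldiv_x_ldiv_y_x_eq_sop_x_ldiv_x_y (x * z) x
  have h7 := ldiv_mul (y * (x * z)) (inn x y (x * z))
  grind only [mul_comm, sop_comm]

theorem ldiv_mul_x_inn_y_z_y_mul_x_z (x y z : Q) :
    ldiv (x * (inn y z y)) (x * z) = inn y x (y * z) := by
  have h1 := inn_inn_x_z_x_y_mul_x_z y x z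
  have h2 := inn_x_y_ldiv_x_z (inn y z y) x z
  have h3 := ldiv_inn_x_y_x_y y z
  grind only [mul_comm]

theorem ldiv_x_ldiv_y_inn_z_y_mul_x_z (x y z : Q) :
    ldiv x (ldiv y (inn z y (x * z))) = sop (ldiv x y) (sop x z) := by
  have h1 := ldiv_mul_x_inn_y_z_y_mul_x_z y z x
  have h2 := ldiv_mul y (inn z x z)
  have h3 := ldiv_y_inn_x_y_x z x
  have h4 := ldiv_x_ldiv_z_inn_y_z_ldiv_y_x x (ldiv y (y * (inn z x z))) y
  have h5 := inn_ldiv_x_y_x_z y (y * (inn z x z)) (ldiv (ldiv y (y * (inn z x z))) x)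
  have h6 := inn_sop_x_y_y_ldiv_ldiv_y_x_z (y * (inn z x z)) y x
  grind only [mul_comm, sop_comm]

theorem inn_ldiv_x_y_z_ldiv_x_sop_x_y (x y z : Q) :
    inn (ldiv x y) z (ldiv x (sop x y)) = z * (ldiv x (sop y (x * z))) := by
  have h1 := inn_x_y_ldiv_x_z (ldiv x y) z x
  have h2 := ldiv_ldiv_x_y_x x y
  have h3 := ldiv_mul z x
  have h4 := mul_x_ldiv_ldiv_x_y_z z (x * z) (sop y (x * z))
  have h5 := inn_y_x_sop_x_z (x * z) z y
  have h6 := ldiv_ldiv_x_y_x (x * z) (inn z (x * z) y)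
  have h7 := mul_x_ldiv_ldiv_x_y_z z (x * z) y
  grind only [mul_comm, sop_comm]

theorem mul_x_mul_y_sop_z_ldiv_y_x (x y z : Q) :
    x * (y * (sop z (ldiv y x))) = inn (y * z) x (inn z y z) := by
  have h1 := inn_ldiv_x_y_z_ldiv_x_sop_x_y y (inn y y z) x
  have h2 := sop_x_inn_x_x_y y z
  have h3 := ldiv_x_sop_mul_x_z_inn_x_x_y y z x
  have h4 := ldiv_x_inn_x_x_y y z
  have h5 := ldiv_mul y (inn z y z)
  grind only [sop_comm]

theorem ldiv_ldiv_x_inn_z_x_y_mul_y_z (x y z : Q) :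
    ldiv (ldiv x (inn z x y)) (y * z) = ldiv x (inn y x z) := by
  have h1 := mul_x_ldiv_ldiv_x_y_z z x y
  have h2 := inn_ldiv_right (ldiv (ldiv z x) y) z x
  have h3 := inn_ldiv_ldiv_x_y_z_x_y z x y
  have h4 := ldiv_z_sop_mul_x_z_inn_y_x_z x y z
  have h5 := inn_eq (ldiv (ldiv z x) y) z (ldiv z x)
  have h6 := mul_ldiv (ldiv z x) y
  grind only [mul_comm]

theorem ldiv_x_inn_y_x_mul_y_z (x y z : Q) :
    ldiv x (inn y x (y * z)) = z * (sop z (sop y (ldiv z x))) := by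
  have h1 := ldiv_ldiv_x_inn_z_x_y_mul_y_z x (inn y z y) (y * z)
  have h2 := mul_x_mul_y_sop_z_ldiv_y_x x z y
  have h3 := inn_inn_x_z_x_y_mul_x_z y x z
  have h4 := ldiv_mul x (z * (sop y (ldiv z x)))
  have h5 := mul_mul_x_y_inn_y_x_z z y y
  have h6 := mul_self y
  have h7 := one_mul z
  have h8 := ldiv_mul_x_y_y (sop y (ldiv z x)) z
  grind only [mul_comm, sop_comm]

theorem sop_x_sop_y_z (x y z : Q) : sop x (sop y z) = sop y (sop x z) := by
  have h1 := ldiv_mul y x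
  have h2 := ldiv_mul y (sop y (sop z (ldiv y (x * y))))
  have h3 := ldiv_x_inn_y_x_mul_y_z (x * y) z y
  have h4 := ldiv_x_ldiv_y_inn_z_y_mul_x_z y (x * y) z
  grind only [mul_comm, sop_comm]

theorem sop_assoc (x y z : Q) : sop (sop x y) z = sop x (sop y z) := by
  have h1 := sop_x_sop_y_z x y z
  have h2 := sop_x_sop_y_z y z x
  grind only [sop_comm]

theorem sop_self (x : Q) : sop x x = 1 := by
  have h1 := ldiv_mul x 1
  rw [mul_one] at h1
  rw [sop, mul_self, ← one_mul (ldiv 1 x), mul_ldiv, h1]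

theorem sop_one (x : Q) : sop x 1 = x := by
  rw [← sop_self x, sop_sop_self]

end CommLoop

theorem card_eq_two_pow_of_assoc_of_self {α : Type*} [Fintype α] (op : α → α → α) (e : α)
    (assoc : ∀ x y z, op (op x y) z = op x (op y z)) (one_op : ∀ x, op e x = x)
    (op_self : ∀ x, op x x = e) : ∃ k : ℕ, Fintype.card α = 2 ^ k := by
  let : Mul α := ⟨op⟩
  let : One α := ⟨e⟩
  let : Inv α := ⟨id⟩
  let : Group α := Group.ofLeftAxioms assoc one_op op_self
  rw [← Nat.card_eq_fintype_card]
  exact IsPGroup.iff_card.mp fun g => ⟨1, by rw [pow_one, pow_two]; exact op_self g⟩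

open CommLoop in
/-- If `Q` is a commutative A-loop of exponent 2, then `(Q, ∘)` with
`x∘y = x\((xy)\x)` is an elementary abelian 2-group; consequently a finite
commutative A-loop of exponent 2 has order a power of 2. -/
theorem stmt19 {Q : Type*} [CommLoop Q] [IsALoop Q] (h2 : ∀ x : Q, x * x = 1) :
    (∀ x y : Q, sop x y = sop y x) ∧
    (∀ x : Q, sop x 1 = x) ∧
    (∀ x : Q, sop 1 x = x) ∧
    (∀ x : Q, sop x x = 1) ∧
    (∀ x y z : Q, sop (sop x y) z = sop x (sop y z)) ∧
    (∀ (inst : Fintype Q), ∃ k : ℕ, @Fintype.card Q inst = 2 ^ k) := by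
  have : ExponentTwo Q := ⟨h2⟩
  have one_sop (x : Q) : sop 1 x = x := by rw [sop_comm, sop_one]
  exact ⟨sop_comm, sop_one, one_sop, sop_self, sop_assoc,
    fun _ => card_eq_two_pow_of_assoc_of_self sop 1 sop_assoc one_sop sop_self⟩
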